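/- Let p, q ∈ ℤ² with q ∧ p ≠ 0, let α ≥ 0, and assume q is of type I₊ relative to p, i.e. ‖q‖ < ‖p‖, ‖q + p‖ = ‖p‖, and ‖q + n·p‖ > ‖p‖ for every integer n ∉ {0,1}. Then for every λ > 0 the limit g(λ) = lim_{k→∞} [λ/ρ_{−1}, λ/ρ_{−2}, …, λ/ρ_{−k}] exists, and a real number λ > 0 admits a square-summable sequence w : ℤ → ℝ satisfying ρ_{n−1} w_{n−1} − ρ_{n+1} w_{n+1} = λ w_n for all n ∈ ℤ together with the sign pattern I₊ if and only if λ/ρ₀ + g(λ) = 0. -/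

import Mathlib

open Filter Topology

/-- Euclidean norm of a point of the integer lattice `ℤ²`. -/
noncomputable def znorm (v : ℤ × ℤ) : ℝ := Real.sqrt ((v.1 : ℝ) ^ 2 + (v.2 : ℝ) ^ 2)

/-- The wedge product `q ∧ p = q₁p₂ − q₂p₁`. -/
def wedge (q p : ℤ × ℤ) : ℤ := q.1 * p.2 - q.2 * p.1

/-- The coefficients `ρ_n` of the linearized α-Euler operator `L_{B,q}`. -/
noncomputable def rho (p q : ℤ × ℤ) (α : ℝ) (n : ℤ) : ℝ :=
  1 - (znorm p ^ 2 * (1 + α ^ 2 * znorm p ^ 2)) /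
      (znorm (q + n • p) ^ 2 * (1 + α ^ 2 * znorm (q + n • p) ^ 2))

/-- Finite continued fraction `[a₁, …, a_k]`, defined by `[a_k] = 1/a_k` and
`[a_j, …, a_k] = 1/(a_j + [a_{j+1}, …, a_k])` (with the empty fraction equal to `0`). -/
noncomputable def cfrac : List ℝ → ℝ
  | [] => 0
  | a :: l => 1 / (a + cfrac l)

/-- Sign pattern `I₊` (one of the two branches): `w_n = 0` for `n > 1`, `w₁ > 0`,
`w₀ < 0`, `w_{−1} < 0`, and `(−1)^{|n|} w_n > 0` for `n ≤ −2`. -/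
def SignIplusAux (w : ℤ → ℝ) : Prop :=
  (∀ n : ℤ, 1 < n → w n = 0) ∧ 0 < w 1 ∧ w 0 < 0 ∧ w (-1) < 0 ∧
    ∀ n : ℤ, n ≤ -2 → 0 < (-1 : ℝ) ^ n.natAbs * w n

/-- A sequence satisfies the sign pattern `I₊` if either it or its negative satisfies
the conditions of `SignIplusAux`. -/
def SignIplus (w : ℤ → ℝ) : Prop := SignIplusAux w ∨ SignIplusAux (fun n => -w n)

/-- The continued fraction `1/(a 0 + 1/(a 1 + ⋯ + 1/(a (k-1) + x)))` with tail `x`. -/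
noncomputable def cfracTail : ℕ → (ℕ → ℝ) → ℝ → ℝ
  | 0, _, x => x
  | k + 1, a, x => 1 / (a 0 + cfracTail k (fun i => a (i + 1)) x)

lemma cfrac_map_range (k : ℕ) (a : ℕ → ℝ) :
    cfrac ((List.range k).map a) = cfracTail k a 0 := by
  induction k generalizing a with
  | zero => simp [cfrac, cfracTail]
  | succ k ih =>
    rw [List.range_succ_eq_map, List.map_cons, List.map_map, cfrac, cfracTail, ← ih]
    rfl

lemma cfracTail_succ_right (k : ℕ) (a : ℕ → ℝ) (x : ℝ) :
    cfracTail (k + 1) a x = cfracTail k a (1 / (a k + x)) := by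
  induction k generalizing a with
  | zero => rfl
  | succ k ih => rw [cfracTail, ih, cfracTail]

lemma cfracTail_nonneg (k : ℕ) {a : ℕ → ℝ} (ha : ∀ i, 0 < a i) {x : ℝ} (hx : 0 ≤ x) :
    0 ≤ cfracTail k a x := by
  induction k generalizing a with
  | zero => exact hx
  | succ k ih =>
    have := ih (a := fun i => a (i + 1)) fun i => ha _
    have := ha 0
    rw [cfracTail]
    positivity

lemma abs_inv_add_sub_le {a c x y : ℝ} (hc : 0 < c) (ha : c ≤ a) (hx : 0 ≤ x) (hy : 0 ≤ y) :
    |1 / (a + x) - 1 / (a + y)| ≤ |x - y| / c ^ 2 := by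
  have h1 : 0 < a + x := by linarith
  have h2 : 0 < a + y := by linarith
  have : 1 / (a + x) - 1 / (a + y) = (y - x) / ((a + x) * (a + y)) := by
    field_simp
    ring
  rw [this, abs_div, abs_sub_comm, abs_of_pos (mul_pos h1 h2), sq]
  gcongr <;> linarith

lemma abs_inv_add_inv_add_sub_le {a b c x y : ℝ} (hc : 0 < c) (ha : c ≤ a) (hb : c ≤ b)
    (hx : 0 ≤ x) (hy : 0 ≤ y) :
    |1 / (a + 1 / (b + x)) - 1 / (a + 1 / (b + y))| ≤ |x - y| / (1 + c ^ 2) ^ 2 := by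
  have ha' : 0 < a := hc.trans_le ha
  have h1 : 0 < b + x := by linarith
  have h2 : 0 < b + y := by linarith
  have h3 : 1 + c ^ 2 ≤ a * (b + x) + 1 := by nlinarith [mul_nonneg ha'.le hx]
  have h4 : 1 + c ^ 2 ≤ a * (b + y) + 1 := by nlinarith [mul_nonneg ha'.le hy]
  have h0 : 0 < 1 + c ^ 2 := by positivity
  have h5 : 0 < a * (b + x) + 1 := h0.trans_le h3
  have h6 : 0 < a * (b + y) + 1 := h0.trans_le h4
  have e1 : 1 / (a + 1 / (b + x)) = (b + x) / (a * (b + x) + 1) := by field_simp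
  have e2 : 1 / (a + 1 / (b + y)) = (b + y) / (a * (b + y) + 1) := by field_simp
  have : 1 / (a + 1 / (b + x)) - 1 / (a + 1 / (b + y))
      = (x - y) / ((a * (b + x) + 1) * (a * (b + y) + 1)) := by
    rw [e1, e2, div_sub_div _ _ h5.ne' h6.ne']
    congr 1
    ring
  rw [this, abs_div, abs_of_pos (mul_pos h5 h6), sq]
  gcongr

lemma abs_cfracTail_sub_le {c : ℝ} (hc : 0 < c) {x y : ℝ} (hx : 0 ≤ x) (hy : 0 ≤ y) :
    ∀ (k : ℕ) {a : ℕ → ℝ}, (∀ i, c ≤ a i) →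
      |cfracTail k a x - cfracTail k a y|
        ≤ |x - y| * ((1 + c ^ 2) / c ^ 2) * (1 / (1 + c ^ 2)) ^ k
  | 0, a, _ => by
    have : 1 ≤ (1 + c ^ 2) / c ^ 2 := by
      rw [le_div_iff₀ (by positivity)]
      linarith
    simpa [cfracTail] using le_mul_of_one_le_right (abs_nonneg (x - y)) this
  | 1, a, ha => by
    refine (abs_inv_add_sub_le hc (ha 0) hx hy).trans_eq ?_
    field_simp
  | k + 2, a, ha => by
    have hpos : ∀ i, 0 < a (i + 1 + 1) := fun i => hc.trans_le (ha _)
    have ih := abs_cfracTail_sub_le hc hx hy k (a := fun i => a (i + 1 + 1)) fun i => ha _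
    refine (abs_inv_add_inv_add_sub_le hc (ha 0) (ha 1) (cfracTail_nonneg k hpos hx)
      (cfracTail_nonneg k hpos hy)).trans ?_
    calc _ ≤ |x - y| * ((1 + c ^ 2) / c ^ 2) * (1 / (1 + c ^ 2)) ^ k / (1 + c ^ 2) ^ 2 := by
          gcongr
      _ = _ := by
          rw [pow_add]
          field_simp

lemma abs_cfracTail_sub_le_of_le_inv {a : ℕ → ℝ} {c : ℝ} (hc : 0 < c) (ha : ∀ i, c ≤ a i)
    {x : ℝ} (hx : 0 ≤ x) (hxc : x ≤ 1 / c) (k : ℕ) :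
    |cfracTail k a 0 - cfracTail k a x|
      ≤ 1 / c * ((1 + c ^ 2) / c ^ 2) * (1 / (1 + c ^ 2)) ^ k := by
  refine (abs_cfracTail_sub_le hc le_rfl hx k ha).trans ?_
  rw [zero_sub, abs_neg, abs_of_nonneg hx]
  gcongr

lemma one_div_one_add_sq_lt_one {c : ℝ} (hc : 0 < c) : 1 / (1 + c ^ 2) < 1 := by
  rw [div_lt_one (by positivity)]
  linarith [pow_pos hc 2]

/-- A continued fraction whose entries are bounded below by a positive constant converges. -/
lemma exists_tendsto_cfracTail {a : ℕ → ℝ} {c : ℝ} (hc : 0 < c) (ha : ∀ i, c ≤ a i) :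
    ∃ g, Tendsto (fun k => cfracTail k a 0) atTop (𝓝 g) := by
  refine cauchySeq_tendsto_of_complete (cauchySeq_of_le_geometric (1 / (1 + c ^ 2))
    (1 / c * ((1 + c ^ 2) / c ^ 2)) (one_div_one_add_sq_lt_one hc) fun k => ?_)
  have hk : 0 < a k := hc.trans_le (ha k)
  rw [Real.dist_eq, cfracTail_succ_right, add_zero]
  exact abs_cfracTail_sub_le_of_le_inv hc ha (by positivity)
    (one_div_le_one_div_of_le hc (ha k)) k

/-- A positive solution of `r k = 1 / (a k + r (k + 1))` starts at the value of the continued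
fraction with entries `a k`. -/
lemma tendsto_cfracTail_of_pos {a r : ℕ → ℝ} {c : ℝ} (hc : 0 < c) (ha : ∀ i, c ≤ a i)
    (hr : ∀ i, 0 < r i) (hrec : ∀ i, r i = 1 / (a i + r (i + 1))) :
    Tendsto (fun k => cfracTail k a 0) atTop (𝓝 (r 0)) := by
  have htail : ∀ k, cfracTail k a (r k) = r 0 := by
    intro k
    induction k with
    | zero => rfl
    | succ k ih => rw [cfracTail_succ_right, ← hrec, ih]
  have hle : ∀ k, r k ≤ 1 / c := fun k => by
    rw [hrec]
    exact one_div_le_one_div_of_le hc (by linarith [ha k, hr (k + 1)])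
  have hgeom := (tendsto_pow_atTop_nhds_zero_of_lt_one (r := 1 / (1 + c ^ 2)) (by positivity)
    (one_div_one_add_sq_lt_one hc)).const_mul (1 / c * ((1 + c ^ 2) / c ^ 2))
  rw [mul_zero] at hgeom
  refine tendsto_iff_dist_tendsto_zero.2 (squeeze_zero (fun _ => dist_nonneg) (fun k => ?_) hgeom)
  rw [Real.dist_eq, ← htail k]
  exact abs_cfracTail_sub_le_of_le_inv hc ha (hr k).le (hle k) k

lemma exists_pos_cfracTail_recurrence {a : ℕ → ℝ} {c : ℝ} (hc : 0 < c) (ha : ∀ i, c ≤ a i) :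
    ∃ r : ℕ → ℝ, (∀ i, 0 < r i) ∧ ∀ i, r i = 1 / (a i + r (i + 1)) := by
  choose r hr using fun m =>
    exists_tendsto_cfracTail (a := fun i => a (i + m)) hc fun i => ha _
  have hnonneg : ∀ m, 0 ≤ r m := fun m => ge_of_tendsto' (hr m) fun k =>
    cfracTail_nonneg k (fun i => hc.trans_le (ha _)) le_rfl
  have hpos : ∀ m, 0 < a m + r (m + 1) := fun m =>
    add_pos_of_pos_of_nonneg (hc.trans_le (ha m)) (hnonneg _)
  have hrec : ∀ m, r m = 1 / (a m + r (m + 1)) := fun m => by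
    refine tendsto_nhds_unique ((hr m).comp (tendsto_add_atTop_nat 1)) ?_
    have := ((hr (m + 1)).const_add (a m)).inv₀ (hpos m).ne'
    rw [← one_div] at this
    refine this.congr fun k => ?_
    simp only [Function.comp_apply, cfracTail, zero_add, one_div]
    simp only [add_assoc, add_comm 1 m]
  exact ⟨r, fun m => by rw [hrec]; exact one_div_pos.2 (hpos m), hrec⟩

/-- If a positive sequence satisfies `u (m + 2) = u m - a m * u (m + 1)` with `a ≥ 0`, then the
sequence `a m * u (m + 1)` is square-summable. -/
lemma summable_sq_mul_of_recurrence {a u : ℕ → ℝ} (ha : ∀ i, 0 ≤ a i) (hu : ∀ i, 0 < u i)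
    (hrec : ∀ m, u m = u (m + 2) + a m * u (m + 1)) :
    Summable fun m => (a m * u (m + 1)) ^ 2 := by
  have hnonneg : ∀ m, 0 ≤ a m * u (m + 1) := fun m => mul_nonneg (ha m) (hu _).le
  have hsum : Summable fun m => a m * u (m + 1) := by
    refine summable_of_sum_range_le (c := u 0 + u 1) hnonneg fun n => ?_
    have : ∑ m ∈ Finset.range n, a m * u (m + 1) = u 0 + u 1 - u n - u (n + 1) := by
      induction n with
      | zero => simp
      | succ n ih =>
        rw [Finset.sum_range_succ, ih]
        linarith [hrec n]
    linarith [hu n, hu (n + 1)]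
  refine Summable.of_nonneg_of_le (fun m => sq_nonneg _) (fun m => ?_)
    (hsum.mul_left (∑' m, a m * u (m + 1)))
  rw [sq]
  exact mul_le_mul_of_nonneg_right (hsum.le_tsum m fun j _ => hnonneg j) (hnonneg m)

section TypeIplus

variable {ρ : ℤ → ℝ} {lam : ℝ}

lemma le_div_of_typeIplus (hpos : ∀ n, n ≠ 0 → n ≠ 1 → 0 < ρ n) (hle : ∀ n, ρ n ≤ 1)
    (hlam : 0 < lam) (i : ℕ) : lam ≤ lam / ρ (-((i : ℤ) + 1)) := by
  rw [le_div_iff₀ (hpos _ (by omega) (by omega))]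
  exact mul_le_of_le_one_right hlam.le (hle _)

lemma add_eq_zero_of_signIplusAux (h0 : ρ 0 < 0) (h1 : ρ 1 = 0)
    (hpos : ∀ n, n ≠ 0 → n ≠ 1 → 0 < ρ n) (hle : ∀ n, ρ n ≤ 1) (hlam : 0 < lam) {g : ℝ}
    (hg : Tendsto (fun k => cfracTail k (fun i => lam / ρ (-((i : ℤ) + 1))) 0) atTop (𝓝 g))
    {w : ℤ → ℝ} (hw : SignIplusAux w)
    (heig : ∀ n, ρ (n - 1) * w (n - 1) - ρ (n + 1) * w (n + 1) = lam * w n) :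
    lam / ρ 0 + g = 0 := by
  obtain ⟨-, -, hw0, hw1, hw2⟩ := hw
  let u : ℕ → ℝ := fun m => (-1) ^ m * (ρ (-(m : ℤ)) * w (-(m : ℤ)))
  have hu : ∀ m, 0 < u m := by
    intro m
    match m with
    | 0 => simpa [u] using mul_pos_of_neg_of_neg h0 hw0
    | 1 => simpa [u] using mul_neg_of_pos_of_neg (hpos (-1) (by omega) (by omega)) hw1
    | m + 2 =>
      have h := hw2 (-((m + 2 : ℕ) : ℤ)) (by push_cast; omega)
      rw [Int.natAbs_neg, Int.natAbs_natCast] at h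
      have := mul_pos (hpos (-((m + 2 : ℕ) : ℤ)) (by push_cast; omega) (by push_cast; omega)) h
      simp only [u]
      linarith
  have hrec : ∀ m : ℕ, u m = u (m + 2) + lam / ρ (-((m : ℤ) + 1)) * u (m + 1) := by
    intro m
    have hρ := (hpos (-((m : ℤ) + 1)) (by omega) (by omega)).ne'
    have h := heig (-((m : ℤ) + 1))
    rw [show -((m : ℤ) + 1) - 1 = -((m : ℤ) + 2) by ring,
      show -((m : ℤ) + 1) + 1 = -(m : ℤ) by ring] at h
    simp only [u]
    push_cast
    have e : lam / ρ (-((m : ℤ) + 1)) *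
        ((-1) ^ (m + 1) * (ρ (-((m : ℤ) + 1)) * w (-((m : ℤ) + 1))))
        = (-1) ^ (m + 1) * (lam * w (-((m : ℤ) + 1))) := by
      field_simp
    rw [e, ← h]
    ring
  have hr := tendsto_cfracTail_of_pos (r := fun m => u (m + 1) / u m) hlam
    (le_div_of_typeIplus hpos hle hlam) (fun m => div_pos (hu _) (hu _)) fun m => by
      have h2 := (hu (m + 1)).ne'
      have := hrec m
      rw [show lam / ρ (-((m : ℤ) + 1)) + u (m + 1 + 1) / u (m + 1) = u m / u (m + 1) by
        rw [this, add_div, mul_div_cancel_right₀ _ h2, add_comm], one_div_div]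
  have hg' := tendsto_nhds_unique hg hr
  have h := heig 0
  simp only [zero_sub, zero_add, h1, zero_mul, sub_zero] at h
  have : g = -(lam / ρ 0) := by
    have hρ := h0.ne
    have hw := hw0.ne
    rw [hg']
    simp [u]
    field_simp
    linarith
  rw [this, add_neg_cancel]

lemma exists_signIplus_of_add_eq_zero (h0 : ρ 0 < 0) (h1 : ρ 1 = 0)
    (hpos : ∀ n, n ≠ 0 → n ≠ 1 → 0 < ρ n) (hle : ∀ n, ρ n ≤ 1) (hlam : 0 < lam) {g : ℝ}
    (hg : Tendsto (fun k => cfracTail k (fun i => lam / ρ (-((i : ℤ) + 1))) 0) atTop (𝓝 g))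
    (hzero : lam / ρ 0 + g = 0) :
    ∃ w : ℤ → ℝ, Summable (fun n : ℤ => (w n) ^ 2) ∧ SignIplus w ∧
      ∀ n, ρ (n - 1) * w (n - 1) - ρ (n + 1) * w (n + 1) = lam * w n := by
  have ha := le_div_of_typeIplus hpos hle hlam
  obtain ⟨r, hr, hrrec⟩ := exists_pos_cfracTail_recurrence hlam ha
  have hgr : g = r 0 := tendsto_nhds_unique hg (tendsto_cfracTail_of_pos hlam ha hr hrrec)
  let u : ℕ → ℝ := fun m => ∏ i ∈ Finset.range m, r i
  have hu : ∀ m, 0 < u m := fun m => Finset.prod_pos fun i _ => hr i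
  have husucc : ∀ m, u (m + 1) = u m * r m := fun m => Finset.prod_range_succ _ _
  have hrec : ∀ m : ℕ, u m = u (m + 2) + lam / ρ (-((m : ℤ) + 1)) * u (m + 1) := by
    intro m
    have hd : lam / ρ (-((m : ℤ) + 1)) + r (m + 1) ≠ 0 :=
      (add_pos (hlam.trans_le (ha m)) (hr _)).ne'
    have : (lam / ρ (-((m : ℤ) + 1)) + r (m + 1)) * r m = 1 := by
      rw [hrrec m, mul_one_div_cancel hd]
    rw [husucc (m + 1), husucc m]
    linear_combination -(u m) * this
  let w : ℤ → ℝ := fun n =>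
    if n ≤ 0 then (-1) ^ n.natAbs * u n.natAbs / ρ n else if n = 1 then 1 / lam else 0
  have hwneg : ∀ m : ℕ, w (-(m : ℤ)) = (-1) ^ m * u m / ρ (-(m : ℤ)) := fun m => by simp [w]
  have hw1 : w 1 = 1 / lam := by simp [w]
  have hwgt : ∀ n : ℤ, 1 < n → w n = 0 := fun n hn => by
    simp only [w]
    rw [if_neg (by omega), if_neg (by omega)]
  have hρ : ∀ m : ℕ, ρ (-(m : ℤ)) ≠ 0 := fun m => by
    rcases eq_or_ne m 0 with rfl | hm
    · simpa using h0.ne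
    · exact (hpos _ (by omega) (by omega)).ne'
  have hz : ∀ m : ℕ, ρ (-(m : ℤ)) * w (-(m : ℤ)) = (-1) ^ m * u m := fun m => by
    rw [hwneg, mul_div_cancel₀ _ (hρ m)]
  refine ⟨w, ?_, Or.inl ⟨hwgt, ?_, ?_, ?_, ?_⟩, ?_⟩
  · refine Summable.of_nat_of_neg ?_ ?_
    · refine (summable_nat_add_iff 2).1 (summable_zero.congr fun n => ?_)
      rw [hwgt _ (by push_cast; omega)]
      simp
    · refine (summable_nat_add_iff 1).1 (((summable_sq_mul_of_recurrence
        (fun i => (hlam.trans_le (ha i)).le) hu hrec).mul_left (1 / lam ^ 2)).congr fun m => ?_)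
      have := hρ (m + 1)
      rw [hwneg, div_pow, mul_pow, mul_pow, div_pow, ← pow_mul, mul_comm (m + 1) 2, pow_mul]
      push_cast at this ⊢
      rw [neg_one_sq, one_pow]
      field_simp
  · rw [hw1]
    positivity
  · have h := hwneg 0
    simp only [Nat.cast_zero, neg_zero, pow_zero, one_mul] at h
    rw [h]
    exact div_neg_of_pos_of_neg (hu 0) h0
  · have h := hwneg 1
    simp only [Nat.cast_one, pow_one] at h
    rw [h]
    exact div_neg_of_neg_of_pos (by linarith [hu 1]) (hpos _ (by omega) (by omega))
  · intro n hn
    obtain ⟨m, rfl⟩ : ∃ m : ℕ, n = -(m : ℤ) := ⟨n.natAbs, by omega⟩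
    rw [hwneg, Int.natAbs_neg, Int.natAbs_natCast, ← mul_div_assoc, ← mul_assoc, ← mul_pow]
    have := hpos (-(m : ℤ)) (by omega) (by omega)
    have := hu m
    norm_num
    positivity
  · intro n
    rcases lt_trichotomy n 0 with hn | rfl | hn
    · obtain ⟨m, rfl⟩ : ∃ m : ℕ, n = -((m + 1 : ℕ) : ℤ) := ⟨n.natAbs - 1, by omega⟩
      have e1 : -((m + 1 : ℕ) : ℤ) - 1 = -((m + 2 : ℕ) : ℤ) := by push_cast; ring
      have e2 : -((m + 1 : ℕ) : ℤ) + 1 = -(m : ℤ) := by push_cast; ring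
      rw [e1, e2, hz, hz, hwneg, hrec m]
      push_cast
      ring
    · have h := hz 1
      have h' := hwneg 0
      have hu0 : u 0 = 1 := by simp [u]
      have hu1 : u 1 = r 0 := by simp [u]
      simp only [Nat.cast_one, pow_one, Nat.cast_zero, neg_zero, pow_zero, one_mul, hu0, hu1]
        at h h'
      rw [zero_sub, zero_add, h, h', h1, ← hgr]
      linear_combination -hzero
    · rcases (show n = 1 ∨ n = 2 ∨ 2 < n by omega) with rfl | rfl | hn'
      · have h := hz 0
        have hu0 : u 0 = 1 := by simp [u]
        simp only [Nat.cast_zero, neg_zero, pow_zero, one_mul, hu0] at h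
        rw [sub_self, h, hwgt _ (by omega), hw1, mul_one_div_cancel hlam.ne']
        simp
      · rw [show (2 : ℤ) - 1 = 1 by norm_num, h1, hwgt (2 + 1) (by omega), hwgt 2 (by omega)]
        simp
      · rw [hwgt _ (by omega), hwgt _ (by omega), hwgt _ (by omega)]
        simp

lemma exists_tendsto_and_eigenvalue_iff (h0 : ρ 0 < 0) (h1 : ρ 1 = 0)
    (hpos : ∀ n, n ≠ 0 → n ≠ 1 → 0 < ρ n) (hle : ∀ n, ρ n ≤ 1) (hlam : 0 < lam) :
    ∃ g : ℝ,
      Tendsto (fun k => cfracTail k (fun i => lam / ρ (-((i : ℤ) + 1))) 0) atTop (𝓝 g) ∧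
      ((∃ w : ℤ → ℝ, Summable (fun n : ℤ => (w n) ^ 2) ∧ SignIplus w ∧
          ∀ n, ρ (n - 1) * w (n - 1) - ρ (n + 1) * w (n + 1) = lam * w n) ↔
        lam / ρ 0 + g = 0) := by
  obtain ⟨g, hg⟩ := exists_tendsto_cfracTail hlam (le_div_of_typeIplus hpos hle hlam)
  refine ⟨g, hg, ?_, exists_signIplus_of_add_eq_zero h0 h1 hpos hle hlam hg⟩
  rintro ⟨w, -, hw | hw, heig⟩
  · exact add_eq_zero_of_signIplusAux h0 h1 hpos hle hlam hg hw heig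
  · exact add_eq_zero_of_signIplusAux h0 h1 hpos hle hlam hg hw fun n => by
      linear_combination -heig n

end TypeIplus

lemma sq_mul_one_add_lt {x y : ℝ} (α : ℝ) (hx : 0 ≤ x) (hxy : x < y) :
    x ^ 2 * (1 + α ^ 2 * x ^ 2) < y ^ 2 * (1 + α ^ 2 * y ^ 2) := by
  have h : x ^ 2 < y ^ 2 := pow_lt_pow_left₀ hxy hx two_ne_zero
  refine mul_lt_mul h ?_ (by positivity) (by positivity)
  gcongr

lemma znorm_nonneg (v : ℤ × ℤ) : 0 ≤ znorm v := Real.sqrt_nonneg _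

lemma znorm_pos {v : ℤ × ℤ} (hv : v ≠ 0) : 0 < znorm v := by
  refine Real.sqrt_pos.2 ?_
  rcases eq_or_ne v.1 0 with h1 | h1
  · have h2 : v.2 ≠ 0 := fun h2 => hv (Prod.ext h1 h2)
    have : (v.2 : ℝ) ≠ 0 := by exact_mod_cast h2
    positivity
  · have : (v.1 : ℝ) ≠ 0 := by exact_mod_cast h1
    positivity

lemma rho_le_one (p q : ℤ × ℤ) (α : ℝ) (n : ℤ) : rho p q α n ≤ 1 := by
  rw [rho, sub_le_self_iff]
  positivity

lemma rho_pos {p q : ℤ × ℤ} {α : ℝ} {n : ℤ} (h : znorm p < znorm (q + n • p)) :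
    0 < rho p q α n := by
  have hp := znorm_nonneg p
  have := hp.trans_lt h
  rw [rho, sub_pos, div_lt_one (by positivity)]
  exact sq_mul_one_add_lt α hp h

lemma rho_neg {p q : ℤ × ℤ} {α : ℝ} {n : ℤ} (h0 : 0 < znorm (q + n • p))
    (h : znorm (q + n • p) < znorm p) : rho p q α n < 0 := by
  rw [rho, sub_neg, one_lt_div (by positivity)]
  exact sq_mul_one_add_lt α h0.le h

lemma rho_eq_zero {p q : ℤ × ℤ} {α : ℝ} {n : ℤ} (h0 : 0 < znorm p)
    (h : znorm (q + n • p) = znorm p) : rho p q α n = 0 := by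
  rw [rho, h, div_self (by positivity), sub_self]

/-- For `q` of type `I₊`: the continued fraction `g(λ)` converges, and `λ > 0` is an
eigenvalue of `L_{B,q}` with eigenvector of sign pattern `I₊` iff `λ/ρ₀ + g(λ) = 0`. -/
theorem eigenvalue_iff_continued_fraction_typeIplus
    (p q : ℤ × ℤ) (hwedge : wedge q p ≠ 0) (α : ℝ) (hα : 0 ≤ α)
    (hq : znorm q < znorm p)
    (hqp : znorm (q + p) = znorm p)
    (hn : ∀ n : ℤ, n ≠ 0 → n ≠ 1 → znorm p < znorm (q + n • p)) :
    ∀ lam : ℝ, 0 < lam →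
      ∃ glam : ℝ,
        Tendsto (fun k : ℕ =>
            cfrac ((List.range k).map fun i => lam / rho p q α (-((i : ℤ) + 1))))
          atTop (nhds glam) ∧
        ((∃ w : ℤ → ℝ, Summable (fun n : ℤ => (w n) ^ 2) ∧ SignIplus w ∧
            ∀ n : ℤ, rho p q α (n - 1) * w (n - 1) - rho p q α (n + 1) * w (n + 1)
              = lam * w n) ↔
          lam / rho p q α 0 + glam = 0) := by
  intro lam hlam
  simp only [bind_pure_comp, List.map_eq_map, List.map_map, cfrac_map_range, Function.comp_def]
  have hq0 : 0 < znorm q := znorm_pos fun h => hwedge (by simp [wedge, h])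
  refine exists_tendsto_and_eigenvalue_iff ?_ ?_ (fun n h0 h1 => rho_pos (hn n h0 h1))
    (rho_le_one p q α) hlam
  · exact rho_neg (by simpa using hq0) (by simpa using hq)
  · exact rho_eq_zero (hq0.trans hq) (by simpa using hqp)
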